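/- The subdiagram H(Φ_short^+) is connected (as an undirected graph) and contains at least one vertex corresponding to a short simple root. -/

import Mathlib

noncomputable section

namespace Paper

/-- The root lattice of rank `l`, with coordinates taken in the basis of simple roots. -/
abbrev RL (l : ℕ) := Fin l → ℤ

/-- The `i`-th simple root `αᵢ`. -/
def sroot (l : ℕ) (i : Fin l) : RL l := Pi.single i 1

/-- The Cartan pairing `⟨v, αᵢ^∨⟩` attached to a Cartan matrix `A`,
with the convention `A i j = ⟨αⱼ, αᵢ^∨⟩`. -/
def cmPair (l : ℕ) (A : Matrix (Fin l) (Fin l) ℤ) (v : RL l) (i : Fin l) : ℤ :=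
  ∑ j, A i j * v j

/-- The closure of a set `S0` of root-lattice vectors under all simple reflections
(computed with respect to the Cartan matrix `A`). -/
def orbitOf (l : ℕ) (A : Matrix (Fin l) (Fin l) ℤ) (S0 : Set (RL l)) : Set (RL l) :=
  ⋂₀ {T | S0 ⊆ T ∧ ∀ v ∈ T, ∀ i : Fin l, v - cmPair l A v i • sroot l i ∈ T}

/-- The set `Φ` of roots of the root system with Cartan matrix `A`:
the orbit of the simple roots under the Weyl group. -/
def rootsOf (l : ℕ) (A : Matrix (Fin l) (Fin l) ℤ) : Set (RL l) :=
  orbitOf l A {v | ∃ i, v = sroot l i}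

/-- The set `Φ⁺` of positive roots. -/
def posRoots (l : ℕ) (A : Matrix (Fin l) (Fin l) ℤ) : Set (RL l) :=
  {v ∈ rootsOf l A | ∀ i, 0 ≤ v i}

/-- The (suitably scaled) squared length `⟨v, v⟩` with respect to the symmetrizer `d`
(`d i` represents half the squared length of `αᵢ`). -/
def nsq (l : ℕ) (A : Matrix (Fin l) (Fin l) ℤ) (d : Fin l → ℤ) (v : RL l) : ℤ :=
  ∑ i, ∑ j, d i * A i j * v i * v j

/-- The set of roots of squared length `c`. -/
def lenSet (l : ℕ) (A : Matrix (Fin l) (Fin l) ℤ) (d : Fin l → ℤ) (c : ℤ) : Set (RL l) :=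
  {v ∈ rootsOf l A | nsq l A d v = c}

/-- The set of positive roots of squared length `c`. -/
def posLen (l : ℕ) (A : Matrix (Fin l) (Fin l) ℤ) (d : Fin l → ℤ) (c : ℤ) : Set (RL l) :=
  {v ∈ lenSet l A d c | ∀ i, 0 ≤ v i}

/-! Cartan matrices (Bourbaki numbering, shifted to be 0-indexed);
the convention is `A i j = ⟨αⱼ, αᵢ^∨⟩`. -/

/-- The Cartan matrix of type `A_l`. -/
def CM_A (l : ℕ) : Matrix (Fin l) (Fin l) ℤ := Matrix.of fun i j =>
  if i = j then 2 else if (i : ℕ) + 1 = (j : ℕ) ∨ (j : ℕ) + 1 = (i : ℕ) then -1 else 0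

/-- The Cartan matrix of type `B_l` (the last simple root is short). -/
def CM_B (l : ℕ) : Matrix (Fin l) (Fin l) ℤ := Matrix.of fun i j =>
  if i = j then 2
  else if (i : ℕ) = (j : ℕ) + 1 then (if (i : ℕ) = l - 1 then -2 else -1)
  else if (j : ℕ) = (i : ℕ) + 1 then -1 else 0

/-- The Cartan matrix of type `C_l` (the last simple root is long). -/
def CM_C (l : ℕ) : Matrix (Fin l) (Fin l) ℤ := Matrix.of fun i j =>
  if i = j then 2
  else if (j : ℕ) = (i : ℕ) + 1 then (if (j : ℕ) = l - 1 then -2 else -1)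
  else if (i : ℕ) = (j : ℕ) + 1 then -1 else 0

/-- The Cartan matrix of type `D_l`. -/
def CM_D (l : ℕ) : Matrix (Fin l) (Fin l) ℤ := Matrix.of fun i j =>
  if i = j then 2
  else if ((i : ℕ) + 1 = (j : ℕ) ∧ (j : ℕ) + 1 ≤ l - 1) ∨
          ((j : ℕ) + 1 = (i : ℕ) ∧ (i : ℕ) + 1 ≤ l - 1) ∨
          ((i : ℕ) = l - 3 ∧ (j : ℕ) = l - 1) ∨ ((j : ℕ) = l - 3 ∧ (i : ℕ) = l - 1) then -1
  else 0

/-- The Cartan matrix of type `E_l` (`l ∈ {6,7,8}`). -/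
def CM_E (l : ℕ) : Matrix (Fin l) (Fin l) ℤ := Matrix.of fun i j =>
  if i = j then 2
  else if ((i : ℕ) = 0 ∧ (j : ℕ) = 2) ∨ ((j : ℕ) = 0 ∧ (i : ℕ) = 2) ∨
          ((i : ℕ) = 1 ∧ (j : ℕ) = 3) ∨ ((j : ℕ) = 1 ∧ (i : ℕ) = 3) ∨
          (2 ≤ (i : ℕ) ∧ (j : ℕ) = (i : ℕ) + 1) ∨
          (2 ≤ (j : ℕ) ∧ (i : ℕ) = (j : ℕ) + 1) then -1
  else 0

/-- The Cartan matrix of type `F₄` (used with `l = 4`; `α₁, α₂` long, `α₃, α₄` short). -/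
def CM_F4 (l : ℕ) : Matrix (Fin l) (Fin l) ℤ := Matrix.of fun i j =>
  if i = j then 2
  else if ((i : ℕ) = 0 ∧ (j : ℕ) = 1) ∨ ((j : ℕ) = 0 ∧ (i : ℕ) = 1) ∨
          ((i : ℕ) = 1 ∧ (j : ℕ) = 2) ∨
          ((i : ℕ) = 2 ∧ (j : ℕ) = 3) ∨ ((j : ℕ) = 2 ∧ (i : ℕ) = 3) then -1
  else if (i : ℕ) = 2 ∧ (j : ℕ) = 1 then -2 else 0

/-- The Cartan matrix of type `G₂` (used with `l = 2`; `α₁` short, `α₂` long). -/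
def CM_G2 (l : ℕ) : Matrix (Fin l) (Fin l) ℤ := Matrix.of fun i j =>
  if i = j then 2
  else if (i : ℕ) = 0 ∧ (j : ℕ) = 1 then -3
  else if (i : ℕ) = 1 ∧ (j : ℕ) = 0 then -1 else 0

/-! Symmetrizers: `d i` is half the squared length of `αᵢ`, scaled so that short
roots have squared length `2` and long roots have squared length `4` (resp. `6` in
type `G₂`). -/

/-- Symmetrizer for type `B_l`. -/
def dB (l : ℕ) : Fin l → ℤ := fun i => if (i : ℕ) = l - 1 then 1 else 2
/-- Symmetrizer for type `C_l`. -/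
def dC (l : ℕ) : Fin l → ℤ := fun i => if (i : ℕ) = l - 1 then 2 else 1
/-- Symmetrizer for type `F₄`. -/
def dF4 (l : ℕ) : Fin l → ℤ := fun i => if (i : ℕ) ≤ 1 then 2 else 1
/-- Symmetrizer for type `G₂`. -/
def dG2 (l : ℕ) : Fin l → ℤ := fun i => if (i : ℕ) = 0 then 1 else 3

/-- Adjacency in (the underlying undirected graph of) the Hasse diagram of a set `P`
of positive roots: two vertices of `P` are joined iff they differ by a simple root. -/
def hstep (l : ℕ) (P : Set (RL l)) (v w : RL l) : Prop :=
  v ∈ P ∧ w ∈ P ∧ ∃ i : Fin l, w = v + sroot l i ∨ v = w + sroot l i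

/-- Connectivity (reachability) in the Hasse diagram of `P`. -/
def hconn (l : ℕ) (P : Set (RL l)) : RL l → RL l → Prop :=
  Relation.ReflTransGen (hstep l P)

/-- The connected component `𝒞₀` of the Hasse diagram `H(Φ_long⁺)` of long positive
roots which contains the long simple roots (long = squared length `4` here; this is
used for types `B`, `C`, `F₄`). -/
def C0 (l : ℕ) (A : Matrix (Fin l) (Fin l) ℤ) (d : Fin l → ℤ) : Set (RL l) :=
  {v | ∃ i : Fin l, sroot l i ∈ lenSet l A d 4 ∧ hconn l (posLen l A d 4) (sroot l i) v}

/-- `A` is a Cartan matrix whose symmetrization by the positive weights `d` is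
positive definite. -/
structure IsPosSymmetrizer (l : ℕ) (A : Matrix (Fin l) (Fin l) ℤ) (d : Fin l → ℤ) : Prop where
  diag : ∀ i, A i i = 2
  one_le : ∀ i, 1 ≤ d i
  symm : ∀ i j, d i * A i j = d j * A j i
  pos : ∀ v, v ≠ 0 → 0 < nsq l A d v

section General

variable {l : ℕ} {A : Matrix (Fin l) (Fin l) ℤ} {d : Fin l → ℤ}

lemma hconn_symm {P : Set (RL l)} {v w : RL l} (h : hconn l P v w) : hconn l P w v := by
  induction h with
  | refl => exact .refl
  | tail _ hab ih =>
    obtain ⟨ha, hb, i, hi⟩ := hab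
    exact .head ⟨hb, ha, i, hi.symm⟩ ih

lemma sroot_mem_rootsOf (i : Fin l) : sroot l i ∈ rootsOf l A := by
  rintro T ⟨hT, -⟩
  exact hT ⟨i, rfl⟩

lemma reflection_mem_rootsOf {v : RL l} (hv : v ∈ rootsOf l A) (i : Fin l) :
    v - cmPair l A v i • sroot l i ∈ rootsOf l A := by
  rintro T hT
  exact hT.2 v (hv T hT) i

lemma nsq_eq_sum_cmPair (v : RL l) : nsq l A d v = ∑ k, d k * v k * cmPair l A v k := by
  simp only [nsq, cmPair, Finset.mul_sum]
  exact Finset.sum_congr rfl fun i _ => Finset.sum_congr rfl fun j _ => by ring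

lemma cmPair_sroot (i k : Fin l) : cmPair l A (sroot l i) k = A k i := by
  simp [cmPair, sroot, Pi.single_apply]

lemma nsq_sroot (i : Fin l) : nsq l A d (sroot l i) = d i * A i i := by
  simp only [nsq_eq_sum_cmPair, cmPair_sroot]
  simp [sroot, Pi.single_apply]

lemma cmPair_sub_smul (v : RL l) (c : ℤ) (i k : Fin l) :
    cmPair l A (v - c • sroot l i) k = cmPair l A v k - c * A k i := by
  rw [← cmPair_sroot (A := A) i k]
  simp only [cmPair, Finset.mul_sum, ← Finset.sum_sub_distrib]
  refine Finset.sum_congr rfl fun j _ => ?_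
  simp only [Pi.sub_apply, Pi.smul_apply, smul_eq_mul]
  ring

lemma IsPosSymmetrizer.nsq_sub_smul (h : IsPosSymmetrizer l A d) (v : RL l) (c : ℤ)
    (i : Fin l) :
    nsq l A d (v - c • sroot l i)
      = nsq l A d v - 2 * c * d i * cmPair l A v i + 2 * c ^ 2 * d i := by
  have hsymm : ∑ k, d k * v k * A k i = d i * cmPair l A v i := by
    rw [cmPair, Finset.mul_sum]
    refine Finset.sum_congr rfl fun k _ => ?_
    linear_combination v k * h.symm k i
  have hsingle (f : Fin l → ℤ) : ∑ k, d k * sroot l i k * f k = d i * f i := by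
    simp [sroot, Pi.single_apply]
  have hA := hsingle fun k => A k i
  have hP := hsingle (cmPair l A v)
  have key : nsq l A d (v - c • sroot l i) = nsq l A d v - c * ∑ k, d k * v k * A k i
      - c * ∑ k, d k * sroot l i k * cmPair l A v k
      + c ^ 2 * ∑ k, d k * sroot l i k * A k i := by
    simp only [nsq_eq_sum_cmPair, cmPair_sub_smul, Finset.mul_sum, ← Finset.sum_sub_distrib,
      ← Finset.sum_add_distrib]
    refine Finset.sum_congr rfl fun k _ => ?_
    simp only [Pi.sub_apply, Pi.smul_apply, smul_eq_mul]
    ring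
  rw [key, hsymm, hA, hP, h.diag]
  ring

lemma IsPosSymmetrizer.nsq_reflection (h : IsPosSymmetrizer l A d) (v : RL l) (i : Fin l) :
    nsq l A d (v - cmPair l A v i • sroot l i) = nsq l A d v := by
  rw [h.nsq_sub_smul]
  ring

lemma IsPosSymmetrizer.sroot_mem_posLen (h : IsPosSymmetrizer l A d) {i : Fin l}
    (hi : d i = 1) : sroot l i ∈ posLen l A d 2 := by
  refine ⟨⟨sroot_mem_rootsOf i, by rw [nsq_sroot, hi, h.diag, one_mul]⟩, fun j => ?_⟩
  by_cases hj : j = i <;> simp [sroot, hj]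

/-- Two short simple roots joined by an edge of the Dynkin diagram are connected
through their sum. -/
lemma IsPosSymmetrizer.hconn_sroot (h : IsPosSymmetrizer l A d) {i j : Fin l}
    (hi : d i = 1) (hj : d j = 1) (hji : A j i = -1) :
    hconn l (posLen l A d 2) (sroot l i) (sroot l j) := by
  have hs : sroot l i - cmPair l A (sroot l i) j • sroot l j = sroot l i + sroot l j := by
    rw [cmPair_sroot, hji]
    module
  have hmem : sroot l i + sroot l j ∈ posLen l A d 2 := by
    refine ⟨⟨hs ▸ reflection_mem_rootsOf (sroot_mem_rootsOf i) j, ?_⟩, fun k => ?_⟩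
    · rw [← hs, h.nsq_reflection, nsq_sroot, hi, h.diag, one_mul]
    · exact add_nonneg ((h.sroot_mem_posLen hi).2 k) ((h.sroot_mem_posLen hj).2 k)
  exact (Relation.ReflTransGen.single ⟨h.sroot_mem_posLen hi, hmem, j, .inl rfl⟩).tail
    ⟨hmem, h.sroot_mem_posLen hj, i, .inr (add_comm _ _)⟩

/-- A short positive root which is not simple remains a short positive root after
subtracting a suitable simple root. -/
lemma IsPosSymmetrizer.exists_sub_sroot_mem (h : IsPosSymmetrizer l A d) {v : RL l}
    (hv : v ∈ posLen l A d 2) (hns : ∀ i, v ≠ sroot l i) :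
    ∃ i, v - sroot l i ∈ posLen l A d 2 := by
  obtain ⟨⟨hroot, hnsq⟩, hnn⟩ := hv
  obtain ⟨i, -, hi⟩ : ∃ i ∈ Finset.univ, 0 < d i * v i * cmPair l A v i := by
    refine Finset.exists_lt_of_sum_lt (f := fun _ => (0 : ℤ)) ?_
    rw [← nsq_eq_sum_cmPair, hnsq]
    simp
  have hd := h.one_le i
  have hvi : 0 < v i := (hnn i).lt_of_ne fun h0 => by simp [← h0] at hi
  have hp : 0 < cmPair l A v i := pos_of_mul_pos_right hi (by positivity)
  have hlt := h.pos (v - (1 : ℤ) • sroot l i) (by simpa [sub_eq_zero] using hns i)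
  rw [h.nsq_sub_smul, hnsq] at hlt
  have hp1 : cmPair l A v i = 1 := by nlinarith
  have hs : v - cmPair l A v i • sroot l i = v - sroot l i := by rw [hp1, one_smul]
  refine ⟨i, ⟨hs ▸ reflection_mem_rootsOf hroot i, ?_⟩, fun j => ?_⟩
  · rw [← hs, h.nsq_reflection, hnsq]
  · by_cases hj : j = i
    · subst hj
      simpa [sroot] using Int.add_one_le_iff.mpr hvi
    · simpa [sroot, Pi.single_apply, hj] using hnn j

lemma IsPosSymmetrizer.exists_hconn_sroot (h : IsPosSymmetrizer l A d) {v : RL l}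
    (hv : v ∈ posLen l A d 2) : ∃ i, d i = 1 ∧ hconn l (posLen l A d 2) v (sroot l i) := by
  induction hn : (∑ i, v i).toNat using Nat.strong_induction_on generalizing v with
  | _ n ih =>
    by_cases hs : ∃ i, v = sroot l i
    · obtain ⟨i, rfl⟩ := hs
      have hi := hv.1.2
      rw [nsq_sroot, h.diag] at hi
      exact ⟨i, by omega, .refl⟩
    · push Not at hs
      obtain ⟨i, hi⟩ := h.exists_sub_sroot_mem hv hs
      have hsum : ∑ k, (v - sroot l i) k = ∑ k, v k - 1 := by
        simp [sroot, Finset.sum_sub_distrib]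
      have hnn := Finset.sum_nonneg fun k (_ : k ∈ Finset.univ) => hi.2 k
      obtain ⟨j, hj, hc⟩ := ih _ (by omega) hi rfl
      exact ⟨j, hj, .head ⟨hv, hi, i, .inr (by simp)⟩ hc⟩

lemma IsPosSymmetrizer.short_connected (h : IsPosSymmetrizer l A d) (i₀ : Fin l)
    (h₀ : d i₀ = 1)
    (hc : ∀ i, d i = 1 → hconn l (posLen l A d 2) (sroot l i) (sroot l i₀)) :
    (∀ v ∈ posLen l A d 2, ∀ w ∈ posLen l A d 2, hconn l (posLen l A d 2) v w) ∧
      ∃ i : Fin l, sroot l i ∈ lenSet l A d 2 := by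
  have hbase {v : RL l} (hv : v ∈ posLen l A d 2) :
      hconn l (posLen l A d 2) v (sroot l i₀) := by
    obtain ⟨i, hi, hvi⟩ := h.exists_hconn_sroot hv
    exact hvi.trans (hc i hi)
  exact ⟨fun v hv w hw => (hbase hv).trans (hconn_symm (hbase hw)),
    i₀, (h.sroot_mem_posLen h₀).1⟩

end General

section Tridiagonal

/-- Enlarging by one row and column the quadratic form of a symmetric tridiagonal matrix. -/
lemma sum_sum_tridiagonal_succ (D : ℕ → ℕ → ℤ) (V : ℕ → ℤ) (m : ℕ)
    (hsymm : D m (m + 1) = D (m + 1) m)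
    (hzero : ∀ j < m, D (m + 1) j = 0 ∧ D j (m + 1) = 0) :
    ∑ i ∈ Finset.range (m + 2), ∑ j ∈ Finset.range (m + 2), D i j * V i * V j
      = ∑ i ∈ Finset.range (m + 1), ∑ j ∈ Finset.range (m + 1), D i j * V i * V j
        + 2 * D (m + 1) m * V m * V (m + 1) + D (m + 1) (m + 1) * V (m + 1) ^ 2 := by
  have hrow : ∑ j ∈ Finset.range (m + 1), D (m + 1) j * V (m + 1) * V j
      = D (m + 1) m * V (m + 1) * V m := by
    rw [Finset.sum_range_succ, Finset.sum_eq_zero, zero_add]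
    intro j hj
    simp [(hzero j (Finset.mem_range.mp hj)).1]
  have hcol : ∑ i ∈ Finset.range (m + 1), D i (m + 1) * V i * V (m + 1)
      = D (m + 1) m * V (m + 1) * V m := by
    rw [Finset.sum_range_succ, Finset.sum_eq_zero, zero_add, hsymm]
    · ring
    intro j hj
    simp [(hzero j (Finset.mem_range.mp hj)).2]
  rw [Finset.sum_range_succ]
  simp only [Finset.sum_range_succ _ (m + 1)]
  rw [Finset.sum_add_distrib, hrow, hcol]
  ring

/-- A multiple of the form of type `A` dominates the square of its last coordinate. -/
lemma le_sum_sum_typeA (D : ℕ → ℕ → ℤ) (V : ℕ → ℤ) (c : ℤ) (hc : 0 < c) (m : ℕ)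
    (hdiag : ∀ i ≤ m, D i i = 2 * c)
    (hoff : ∀ i < m, D i (i + 1) = -c ∧ D (i + 1) i = -c)
    (hzero : ∀ i ≤ m, ∀ j, j + 1 < i → D i j = 0 ∧ D j i = 0) :
    c * V m ^ 2
        ≤ ∑ i ∈ Finset.range (m + 1), ∑ j ∈ Finset.range (m + 1), D i j * V i * V j ∧
      (∑ i ∈ Finset.range (m + 1), ∑ j ∈ Finset.range (m + 1), D i j * V i * V j
        = c * V m ^ 2 → ∀ i ≤ m, V i = 0) := by
  induction m with
  | zero =>
    have h0 : 0 ≤ c * V 0 ^ 2 := by positivity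
    simp only [zero_add, Finset.sum_range_one, hdiag 0 le_rfl]
    refine ⟨by nlinarith, fun h i hi => ?_⟩
    obtain rfl : i = 0 := by omega
    have : c * V 0 ^ 2 = 0 := by linarith
    simpa [hc.ne'] using this
  | succ m ih =>
    obtain ⟨hle, heq⟩ := ih (fun i hi => hdiag i (by omega)) (fun i hi => hoff i (by omega))
      (fun i hi => hzero i (by omega))
    obtain ⟨ho, ho'⟩ := hoff m (by omega)
    rw [sum_sum_tridiagonal_succ D V m (ho.trans ho'.symm)
      (fun j hj => hzero (m + 1) le_rfl j (by omega)), ho', hdiag (m + 1) le_rfl]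
    have hsq : 0 ≤ c * (V m - V (m + 1)) ^ 2 := by positivity
    refine ⟨by linarith, fun h => ?_⟩
    have hz := heq (by linarith)
    have hm := hz m le_rfl
    have hlast : c * (V m - V (m + 1)) ^ 2 = 0 := by linarith
    have hV : V (m + 1) = 0 := by simpa [hc.ne', hm] using hlast
    intro i hi
    obtain hi | rfl := hi.lt_or_eq
    · exact hz i (by omega)
    · exact hV

/-- Positivity of the forms of types `B` and `C`, seen as extensions of type `A`. -/
lemma sum_sum_pos_of_typeA_succ (D : ℕ → ℕ → ℤ) (V : ℕ → ℤ) (c a : ℤ) (hc : 0 < c) (m : ℕ)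
    (ha : a ≠ 0)
    (hdiag : ∀ i ≤ m, D i i = 2 * c)
    (hoff : ∀ i < m, D i (i + 1) = -c ∧ D (i + 1) i = -c)
    (hzero : ∀ i ≤ m + 1, ∀ j, j + 1 < i → D i j = 0 ∧ D j i = 0)
    (hlast : D (m + 1) (m + 1) = c * a ^ 2)
    (hedge : D m (m + 1) = -c * a ∧ D (m + 1) m = -c * a)
    (hV : ∃ i ≤ m + 1, V i ≠ 0) :
    0 < ∑ i ∈ Finset.range (m + 2), ∑ j ∈ Finset.range (m + 2), D i j * V i * V j := by
  obtain ⟨hle, heq⟩ := le_sum_sum_typeA D V c hc m hdiag hoff (fun i hi => hzero i (by omega))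
  rw [sum_sum_tridiagonal_succ D V m (hedge.1.trans hedge.2.symm)
      (fun j hj => hzero (m + 1) le_rfl j (by omega)), hedge.2, hlast]
  have hsq : 0 ≤ c * (V m - a * V (m + 1)) ^ 2 := by positivity
  by_contra! hneg
  have hz := heq (by linarith)
  have hm := hz m le_rfl
  have hsq0 : c * (V m - a * V (m + 1)) ^ 2 = 0 := by linarith
  have hV0 : V (m + 1) = 0 := by simpa [hc.ne', hm, ha] using hsq0
  obtain ⟨i, hi, hne⟩ := hV
  obtain hi | rfl := hi.lt_or_eq
  · exact hne (hz i (by omega))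
  · exact hne hV0

lemma nsq_eq_sum_range {l : ℕ} {A : Matrix (Fin l) (Fin l) ℤ} {d : Fin l → ℤ}
    (D : ℕ → ℕ → ℤ) (hD : ∀ i j : Fin l, D i j = d i * A i j) (v : RL l) (V : ℕ → ℤ)
    (hV : ∀ i : Fin l, V i = v i) :
    nsq l A d v
      = ∑ i ∈ Finset.range l, ∑ j ∈ Finset.range l, D i j * V i * V j := by
  rw [← Fin.sum_univ_eq_sum_range (fun i => ∑ j ∈ Finset.range l, D i j * V i * V j)]
  refine Finset.sum_congr rfl fun i _ => ?_
  rw [← Fin.sum_univ_eq_sum_range (fun j => D i j * V i * V j)]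
  exact Finset.sum_congr rfl fun j _ => by rw [hD, hV, hV]

/-- Positivity of a form on `Fin (m + 2)` given by a matrix of type `B` or `C`. -/
lemma nsq_pos_of_typeA_succ {m : ℕ} {A : Matrix (Fin (m + 2)) (Fin (m + 2)) ℤ}
    {d : Fin (m + 2) → ℤ} (D : ℕ → ℕ → ℤ) (hD : ∀ i j : Fin (m + 2), D i j = d i * A i j)
    (c a : ℤ) (hc : 0 < c) (ha : a ≠ 0)
    (hdiag : ∀ i ≤ m, D i i = 2 * c)
    (hoff : ∀ i < m, D i (i + 1) = -c ∧ D (i + 1) i = -c)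
    (hzero : ∀ i ≤ m + 1, ∀ j, j + 1 < i → D i j = 0 ∧ D j i = 0)
    (hlast : D (m + 1) (m + 1) = c * a ^ 2)
    (hedge : D m (m + 1) = -c * a ∧ D (m + 1) m = -c * a)
    (v : RL (m + 2)) (hv : v ≠ 0) : 0 < nsq (m + 2) A d v := by
  obtain ⟨i, hi⟩ := Function.ne_iff.mp hv
  obtain ⟨V, hV⟩ : ∃ V : ℕ → ℤ, ∀ k : Fin (m + 2), V k = v k :=
    ⟨fun n => if h : n < m + 2 then v ⟨n, h⟩ else 0, fun k => by simp⟩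
  rw [nsq_eq_sum_range D hD v V hV]
  refine sum_sum_pos_of_typeA_succ D _ c a hc m ha hdiag hoff hzero hlast hedge
    ⟨i, by omega, ?_⟩
  rw [hV]
  exact hi

end Tridiagonal

lemma isPosSymmetrizer_B (m : ℕ) : IsPosSymmetrizer (m + 2) (CM_B (m + 2)) (dB (m + 2)) where
  diag i := by simp [CM_B]
  one_le i := by
    unfold dB
    split_ifs <;> norm_num
  symm i j := by
    simp only [CM_B, dB, Matrix.of_apply, Fin.ext_iff]
    grind
  pos := by
    refine nsq_pos_of_typeA_succ
      (fun i j => if i = j then (if i = m + 1 then 2 else 4)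
        else if i = j + 1 ∨ j = i + 1 then -2 else 0) ?_ 2 1 (by norm_num) (by norm_num)
      ?_ ?_ ?_ ?_ ?_
    · intro i j
      simp only [CM_B, dB, Matrix.of_apply, Fin.ext_iff]
      grind
    all_goals grind

lemma isPosSymmetrizer_C (m : ℕ) : IsPosSymmetrizer (m + 2) (CM_C (m + 2)) (dC (m + 2)) where
  diag i := by simp [CM_C]
  one_le i := by
    unfold dC
    split_ifs <;> norm_num
  symm i j := by
    simp only [CM_C, dC, Matrix.of_apply, Fin.ext_iff]
    grind
  pos := by
    refine nsq_pos_of_typeA_succ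
      (fun i j => if i = j then (if i = m + 1 then 4 else 2)
        else if i = j + 1 ∨ j = i + 1 then (if i = m + 1 ∨ j = m + 1 then -2 else -1) else 0)
      ?_ 1 2 (by norm_num) (by norm_num) ?_ ?_ ?_ ?_ ?_
    · intro i j
      simp only [CM_C, dC, Matrix.of_apply, Fin.ext_iff]
      grind
    all_goals grind

lemma isPosSymmetrizer_F4 : IsPosSymmetrizer 4 (CM_F4 4) (dF4 4) where
  diag := by decide
  one_le := by decide
  symm := by decide
  pos v hv := by
    have hnsq : nsq 4 (CM_F4 4) (dF4 4) v = 4 * v 0 ^ 2 + 4 * v 1 ^ 2 + 2 * v 2 ^ 2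
        + 2 * v 3 ^ 2 - 4 * v 0 * v 1 - 4 * v 1 * v 2 - 2 * v 2 * v 3 := by
      simp [nsq, CM_F4, dF4, Fin.sum_univ_four]
      ring
    rw [hnsq]
    by_contra! hneg
    have hsos : 6 * (2 * v 0 - v 1) ^ 2 + 2 * (3 * v 1 - 2 * v 2) ^ 2
        + 3 * (2 * v 3 - v 2) ^ 2 + v 2 ^ 2 ≤ 0 := by linarith
    have h2 : v 2 = 0 := by
      rw [← sq_eq_zero_iff]
      linarith [sq_nonneg (v 2), sq_nonneg (2 * v 0 - v 1), sq_nonneg (3 * v 1 - 2 * v 2),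
        sq_nonneg (2 * v 3 - v 2)]
    rw [h2] at hsos
    have h3 : v 3 = 0 := by
      rw [← sq_eq_zero_iff]
      linarith [sq_nonneg (v 3), sq_nonneg (2 * v 0 - v 1), sq_nonneg (v 1)]
    have h1 : v 1 = 0 := by
      rw [← sq_eq_zero_iff]
      linarith [sq_nonneg (v 3), sq_nonneg (2 * v 0 - v 1), sq_nonneg (v 1)]
    rw [h1] at hsos
    have h0 : v 0 = 0 := by
      rw [← sq_eq_zero_iff]
      linarith [sq_nonneg (v 3), sq_nonneg (v 0)]
    refine hv (funext fun i => ?_)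
    fin_cases i <;> assumption

lemma isPosSymmetrizer_G2 : IsPosSymmetrizer 2 (CM_G2 2) (dG2 2) where
  diag := by decide
  one_le := by decide
  symm := by decide
  pos v hv := by
    have hnsq : nsq 2 (CM_G2 2) (dG2 2) v = 2 * v 0 ^ 2 + 6 * v 1 ^ 2 - 6 * v 0 * v 1 := by
      simp [nsq, CM_G2, dG2, Fin.sum_univ_two]
      ring
    rw [hnsq]
    by_contra! hneg
    have h1 : v 1 = 0 := by
      rw [← sq_eq_zero_iff]
      linarith [sq_nonneg (v 1), sq_nonneg (2 * v 0 - 3 * v 1)]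
    rw [h1] at hneg
    have h0 : v 0 = 0 := by
      rw [← sq_eq_zero_iff]
      linarith [sq_nonneg (v 0)]
    refine hv (funext fun i => ?_)
    fin_cases i <;> assumption

/-- In types `B_l (l ≥ 2)`, `C_l (l ≥ 2)`, `F₄` and `G₂`, the
subdiagram `H(Φ_short⁺)` is connected and contains a vertex corresponding to a
short simple root. -/
theorem short_diagram_connected :
    (∀ l : ℕ, 2 ≤ l →
      (∀ v ∈ posLen l (CM_B l) (dB l) 2, ∀ w ∈ posLen l (CM_B l) (dB l) 2,
        hconn l (posLen l (CM_B l) (dB l) 2) v w) ∧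
      ∃ i : Fin l, sroot l i ∈ lenSet l (CM_B l) (dB l) 2) ∧
    (∀ l : ℕ, 2 ≤ l →
      (∀ v ∈ posLen l (CM_C l) (dC l) 2, ∀ w ∈ posLen l (CM_C l) (dC l) 2,
        hconn l (posLen l (CM_C l) (dC l) 2) v w) ∧
      ∃ i : Fin l, sroot l i ∈ lenSet l (CM_C l) (dC l) 2) ∧
    ((∀ v ∈ posLen 4 (CM_F4 4) (dF4 4) 2, ∀ w ∈ posLen 4 (CM_F4 4) (dF4 4) 2,
        hconn 4 (posLen 4 (CM_F4 4) (dF4 4) 2) v w) ∧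
      ∃ i : Fin 4, sroot 4 i ∈ lenSet 4 (CM_F4 4) (dF4 4) 2) ∧
    ((∀ v ∈ posLen 2 (CM_G2 2) (dG2 2) 2, ∀ w ∈ posLen 2 (CM_G2 2) (dG2 2) 2,
        hconn 2 (posLen 2 (CM_G2 2) (dG2 2) 2) v w) ∧
      ∃ i : Fin 2, sroot 2 i ∈ lenSet 2 (CM_G2 2) (dG2 2) 2) := by
  refine ⟨fun l hl => ?_, fun l hl => ?_, ?_, ?_⟩
  · obtain ⟨m, rfl⟩ := Nat.exists_eq_add_of_le' hl
    refine (isPosSymmetrizer_B m).short_connected (Fin.last _) (by simp [dB]) fun i hi => ?_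
    obtain rfl : i = Fin.last _ := by
      simp only [dB] at hi
      grind
    exact .refl
  · obtain ⟨m, rfl⟩ := Nat.exists_eq_add_of_le' hl
    refine (isPosSymmetrizer_C m).short_connected 0 (by simp [dC]) ?_
    rintro ⟨n, hn⟩ hi
    induction n with
    | zero => exact .refl
    | succ n ih =>
      have hn' : n + 1 ≠ m + 1 := fun h => by simp [dC, h] at hi
      have hi' : dC (m + 2) ⟨n, by omega⟩ = 1 := by
        simp only [dC]
        grind
      refine ((isPosSymmetrizer_C m).hconn_sroot hi hi' ?_).trans (ih _ hi')
      simp only [CM_C, Matrix.of_apply]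
      grind
  · refine isPosSymmetrizer_F4.short_connected 3 (by decide) fun i hi => ?_
    obtain rfl | rfl : i = 2 ∨ i = 3 := by
      revert i
      decide
    · exact isPosSymmetrizer_F4.hconn_sroot (by decide) (by decide) (by decide)
    · exact .refl
  · refine isPosSymmetrizer_G2.short_connected 0 (by decide) fun i hi => ?_
    obtain rfl : i = 0 := by
      revert i
      decide
    exact .refl

end Paper

end
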